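/- There is no voting method F on profiles over {a,b,c,d} satisfying all of: positive involvement, the Condorcet winner criterion, the Condorcet loser criterion, ordinal margin invariance, and uniqueness of winners on profiles whose ordinal margin graph is a linearly edge-ordered tournament. -/

import Mathlib

open scoped Classical

/-- A profile assigns to each voter in a finite nonempty set of voters a
preference relation on the alternatives. -/
structure Profile (α V : Type*) where
  voters : Finset V
  pref : V → α → α → Prop
  voters_nonempty : voters.Nonempty

/-- The number of voters strictly preferring `x` to `y` (as an integer). -/
noncomputable def Profile.support {α V : Type*} (P : Profile α V) (x y : α) : ℤ :=
  ((P.voters.filter fun i => P.pref i x y).card : ℤ)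

/-- The majority margin of `x` over `y`. -/
noncomputable def Profile.margin {α V : Type*} (P : Profile α V) (x y : α) : ℤ :=
  P.support x y - P.support y x

/-- Every voter's preference is a strict linear order. -/
def Profile.linear {α V : Type*} (P : Profile α V) : Prop :=
  ∀ i ∈ P.voters,
    (∀ x, ¬ P.pref i x x) ∧
    (∀ x y z, P.pref i x y → P.pref i y z → P.pref i x z) ∧
    (∀ x y, x ≠ y → P.pref i x y ∨ P.pref i y x)

/-- Every voter's preference is a strict weak order. -/
def Profile.swo {α V : Type*} (P : Profile α V) : Prop :=
  ∀ i ∈ P.voters,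
    (∀ x, ¬ P.pref i x x) ∧
    (∀ x y z, P.pref i x y → P.pref i y z → P.pref i x z) ∧
    (∀ x y z, (¬ P.pref i x y ∧ ¬ P.pref i y x) → (¬ P.pref i y z ∧ ¬ P.pref i z y) →
      (¬ P.pref i x z ∧ ¬ P.pref i z x))

/-- The defensible set of a profile. -/
noncomputable def Profile.defensible {α V : Type*} (P : Profile α V) : Set α :=
  {x | ∀ y, ∃ z, P.margin y x ≤ P.margin z y}

inductive Alt : Type
  | a | b | c | d
deriving DecidableEq

open Alt

/-- Same ordinal margin graph: same positive-margin edges and same ordering of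
edges by margin size. -/
noncomputable def omgEq {V W : Type*} (P : Profile Alt V) (P' : Profile Alt W) : Prop :=
  (∀ x y : Alt, 0 < P.margin x y ↔ 0 < P'.margin x y) ∧
  (∀ x y z w : Alt, 0 < P.margin x y → 0 < P.margin z w →
    (P.margin x y < P.margin z w ↔ P'.margin x y < P'.margin z w))

instance : Fintype Alt := ⟨{a, b, c, d}, by rintro (_ | _ | _ | _) <;> decide⟩

/-- The strict preference expressed by a ballot, a list of alternatives from best to worst. -/
abbrev prefers (l : List Alt) (x y : Alt) : Prop := l.idxOf x < l.idxOf y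

/-- The contribution of a single ballot to the margins. -/
def ballotMargin (l : List Alt) (x y : Alt) : ℤ :=
  (if prefers l x y then 1 else 0) - (if prefers l y x then 1 else 0)

/-- The contribution of a list of ballots to the margins. -/
def ballotsMargin (L : List (List Alt)) (x y : Alt) : ℤ :=
  (L.map fun l => ballotMargin l x y).sum

/-- The skew-symmetric function with the given values above the diagonal. -/
def margins (ab ac ad bc bd cd : ℤ) : Alt → Alt → ℤ
  | a, b => ab | a, c => ac | a, d => ad | b, c => bc | b, d => bd | c, d => cd
  | b, a => -ab | c, a => -ac | d, a => -ad | c, b => -bc | d, b => -bd | d, c => -cd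
  | a, a => 0 | b, b => 0 | c, c => 0 | d, d => 0

/-- Two margin functions have the same positive entries, ordered in the same way. -/
def SameOrder (m m' : Alt → Alt → ℤ) : Prop :=
  (∀ x y, 0 < m x y ↔ 0 < m' x y) ∧
  (∀ x y z w, 0 < m x y → 0 < m z w → (m x y < m z w ↔ m' x y < m' z w))

instance (m m' : Alt → Alt → ℤ) : Decidable (SameOrder m m') :=
  inferInstanceAs (Decidable (_ ∧ _))

theorem SameOrder.symm {m m' : Alt → Alt → ℤ} (h : SameOrder m m') : SameOrder m' m :=
  ⟨fun x y => (h.1 x y).symm, fun x y z w hxy hzw =>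
    (h.2 x y z w ((h.1 x y).2 hxy) ((h.1 z w).2 hzw)).symm⟩

theorem sameOrder_two_mul (m : Alt → Alt → ℤ) : SameOrder m fun x y => 2 * m x y :=
  ⟨fun x y => by lia, fun x y z w _ _ => by lia⟩

theorem SameOrder.trans {m m' m'' : Alt → Alt → ℤ} (h : SameOrder m m')
    (h' : SameOrder m' m'') : SameOrder m m'' :=
  ⟨fun x y => (h.1 x y).trans (h'.1 x y), fun x y z w hxy hzw =>
    (h.2 x y z w hxy hzw).trans (h'.2 x y z w ((h.1 x y).1 hxy) ((h.1 z w).1 hzw))⟩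

section

variable {V : Type*}

/-- The profile `P` consists of linear orders and has margins `m`. -/
def Realizes (P : Profile Alt V) (m : Alt → Alt → ℤ) : Prop :=
  P.linear ∧ ∀ x y, P.margin x y = m x y

theorem prefers_linear {l : List Alt} (hl : ∀ x, x ∈ l) :
    (∀ x, ¬ prefers l x x) ∧
    (∀ x y z, prefers l x y → prefers l y z → prefers l x z) ∧
    (∀ x y, x ≠ y → prefers l x y ∨ prefers l y x) :=
  ⟨fun _ => lt_irrefl _, fun _ _ _ => lt_trans,
    fun x _ hxy => lt_or_gt_of_ne fun h => hxy ((List.idxOf_inj (hl x)).1 h)⟩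

theorem exists_realizes_ballotMargin [Nonempty V] {l : List Alt} (hl : ∀ x, x ∈ l) :
    ∃ P : Profile Alt V, Realizes P (ballotMargin l) := by
  obtain ⟨j⟩ := ‹Nonempty V›
  refine ⟨⟨{j}, fun _ => prefers l, Finset.singleton_nonempty j⟩,
    fun i _ => prefers_linear hl, fun x y => ?_⟩
  simp only [Profile.margin, Profile.support, ballotMargin, Finset.filter_singleton]
  split_ifs <;> simp

theorem exists_addVoter [Infinite V] {P : Profile Alt V} (hP : P.linear) {l : List Alt}
    (hl : ∀ x, x ∈ l) :
    ∃ (P' : Profile Alt V) (j : V), j ∉ P.voters ∧ P'.voters = insert j P.voters ∧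
      (∀ i ∈ P.voters, ∀ u v, P'.pref i u v ↔ P.pref i u v) ∧
      (∀ u v, P'.pref j u v ↔ prefers l u v) ∧ P'.linear ∧
      ∀ x y, P'.margin x y = P.margin x y + ballotMargin l x y := by
  obtain ⟨j, hj⟩ := Infinite.exists_notMem_finset P.voters
  have hpref : ∀ i ∈ P.voters, (if i = j then prefers l else P.pref i) = P.pref i :=
    fun i hi => if_neg (ne_of_mem_of_not_mem hi hj)
  refine ⟨⟨insert j P.voters, fun i => if i = j then prefers l else P.pref i,
    Finset.insert_nonempty _ _⟩, j, hj, rfl, fun i hi u v => by simp only [hpref i hi],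
    fun u v => by simp, fun i hi => ?_, fun x y => ?_⟩
  · rcases Finset.mem_insert.1 hi with rfl | hi
    · simpa using prefers_linear hl
    · simpa only [hpref i hi] using hP i hi
  · have key : ∀ u v : Alt, (((insert j P.voters).filter fun i =>
        (if i = j then prefers l else P.pref i) u v).card : ℤ) =
        (P.voters.filter fun i => P.pref i u v).card + if prefers l u v then 1 else 0 := by
      intro u v
      have h : (P.voters.filter fun i => (if i = j then prefers l else P.pref i) u v) =
          P.voters.filter fun i => P.pref i u v :=
        Finset.filter_congr fun i hi => by rw [hpref i hi]
      rw [Finset.filter_insert, h]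
      by_cases huv : prefers l u v
      · simp [huv, hj]
      · simp [huv]
    simp only [Profile.margin, Profile.support, key, ballotMargin]
    ring

theorem exists_realizes_add_ballotMargin [Infinite V] {m : Alt → Alt → ℤ}
    (h : ∃ P : Profile Alt V, Realizes P m) {l : List Alt} (hl : ∀ x, x ∈ l) :
    ∃ P : Profile Alt V, Realizes P fun x y => m x y + ballotMargin l x y := by
  obtain ⟨P, hP, hm⟩ := h
  obtain ⟨P', -, -, -, -, -, hP', hm'⟩ := exists_addVoter hP hl
  exact ⟨P', hP', fun x y => by rw [hm', hm]⟩

theorem exists_realizes_add_pair [Infinite V] (l l' : List Alt) (hl : ∀ x, x ∈ l)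
    (hl' : ∀ x, x ∈ l') (k : ℕ) {m : Alt → Alt → ℤ} (h : ∃ P : Profile Alt V, Realizes P m) :
    ∃ P : Profile Alt V, Realizes P
      fun x y => m x y + k * (ballotMargin l x y + ballotMargin l' x y) := by
  induction k with
  | zero => simpa using h
  | succ k ih =>
    have := exists_realizes_add_ballotMargin (exists_realizes_add_ballotMargin ih hl) hl'
    convert this using 3
    funext x y
    push_cast
    ring

/-- Adding multiples of a skew-symmetric function with a single positive entry. -/
theorem exists_realizes_add_edge [Infinite V] (l₁ l₂ l₁' l₂' : List Alt) (e : Alt → Alt → ℤ)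
    (h₁ : ∀ x, x ∈ l₁) (h₂ : ∀ x, x ∈ l₂) (h₁' : ∀ x, x ∈ l₁') (h₂' : ∀ x, x ∈ l₂')
    (he : ∀ x y, ballotMargin l₁ x y + ballotMargin l₂ x y = 2 * e x y)
    (he' : ∀ x y, ballotMargin l₁' x y + ballotMargin l₂' x y = -(2 * e x y)) (n : ℤ)
    {m : Alt → Alt → ℤ} (h : ∃ P : Profile Alt V, Realizes P m) :
    ∃ P : Profile Alt V, Realizes P fun x y => m x y + 2 * (n * e x y) := by
  obtain ⟨k, rfl | rfl⟩ := n.eq_nat_or_neg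
  · convert exists_realizes_add_pair l₁ l₂ h₁ h₂ k h using 3
    funext x y
    rw [he]
    ring
  · convert exists_realizes_add_pair l₁' l₂' h₁' h₂' k h using 3
    funext x y
    rw [he']
    ring

/-- Even skew-symmetric functions are realized as margins. -/
theorem exists_realizes_two_mul_margins [Infinite V] (p q r s t u : ℤ) :
    ∃ P : Profile Alt V, Realizes P fun x y => 2 * margins p q r s t u x y := by
  have h₀ : ∃ P : Profile Alt V, Realizes P fun _ _ => 0 := by
    have := exists_realizes_add_ballotMargin (V := V) (l := [d, c, b, a])
      (exists_realizes_ballotMargin (l := [a, b, c, d]) (by decide)) (by decide)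
    convert this using 3
    funext x y
    revert x y
    decide
  have h₁ := exists_realizes_add_edge [a, b, c, d] [d, c, a, b] [b, a, c, d] [d, c, b, a]
    (margins 1 0 0 0 0 0) (by decide) (by decide) (by decide) (by decide) (by decide)
    (by decide) p h₀
  have h₂ := exists_realizes_add_edge [a, c, b, d] [d, b, a, c] [c, a, b, d] [d, b, c, a]
    (margins 0 1 0 0 0 0) (by decide) (by decide) (by decide) (by decide) (by decide)
    (by decide) q h₁
  have h₃ := exists_realizes_add_edge [a, d, b, c] [c, b, a, d] [d, a, b, c] [c, b, d, a]
    (margins 0 0 1 0 0 0) (by decide) (by decide) (by decide) (by decide) (by decide)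
    (by decide) r h₂
  have h₄ := exists_realizes_add_edge [b, c, a, d] [d, a, b, c] [c, b, a, d] [d, a, c, b]
    (margins 0 0 0 1 0 0) (by decide) (by decide) (by decide) (by decide) (by decide)
    (by decide) s h₃
  have h₅ := exists_realizes_add_edge [b, d, a, c] [c, a, b, d] [d, b, a, c] [c, a, d, b]
    (margins 0 0 0 0 1 0) (by decide) (by decide) (by decide) (by decide) (by decide)
    (by decide) t h₄
  have h₆ := exists_realizes_add_edge [c, d, a, b] [b, a, c, d] [d, c, a, b] [b, a, d, c]
    (margins 0 0 0 0 0 1) (by decide) (by decide) (by decide) (by decide) (by decide)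
    (by decide) u h₅
  convert h₆ using 3
  funext x y
  cases x <;> cases y <;> simp [margins]

/-- Voting methods meeting all the criteria of the impossibility theorem. -/
structure MeetsCriteria (F : Profile Alt V → Finset Alt) : Prop where
  nonempty : ∀ P : Profile Alt V, P.linear → (F P).Nonempty
  positive_involvement : ∀ (P P' : Profile Alt V) (j : V) (x : Alt), P.linear → P'.linear →
    j ∉ P.voters → P'.voters = insert j P.voters →
    (∀ i ∈ P.voters, ∀ u v : Alt, P'.pref i u v ↔ P.pref i u v) →
    (∀ y : Alt, y ≠ x → P'.pref j x y) → x ∈ F P → x ∈ F P'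
  condorcet_winner : ∀ (P : Profile Alt V) (x : Alt), P.linear →
    (∀ y : Alt, y ≠ x → 0 < P.margin x y) → F P = {x}
  condorcet_loser : ∀ (P : Profile Alt V) (x : Alt), P.linear →
    (∀ y : Alt, y ≠ x → 0 < P.margin y x) → x ∉ F P
  ordinal_margin_invariance : ∀ P P' : Profile Alt V, P.linear → P'.linear → omgEq P P' →
    F P = F P'
  card_eq_one : ∀ P : Profile Alt V, P.linear →
    (∀ x y : Alt, x ≠ y → P.margin x y ≠ 0) →
    (∀ x y z w : Alt, x ≠ y → z ≠ w → ({x, y} : Finset Alt) ≠ {z, w} →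
      |P.margin x y| ≠ |P.margin z w|) → (F P).card = 1

/-- `x` wins in some linear profile with margins `m`. -/
def Wins (F : Profile Alt V → Finset Alt) (m : Alt → Alt → ℤ) (x : Alt) : Prop :=
  ∃ P : Profile Alt V, Realizes P m ∧ x ∈ F P

/-- `x` wins in some linear profile whose margins are twice the values of `m`. -/
abbrev Selects (F : Profile Alt V → Finset Alt) (m : Alt → Alt → ℤ) (x : Alt) : Prop :=
  Wins F (fun u v => 2 * m u v) x

variable {F : Profile Alt V → Finset Alt} {m m' : Alt → Alt → ℤ} {x : Alt}

theorem MeetsCriteria.eq_of_sameOrder (hF : MeetsCriteria F) {P P' : Profile Alt V}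
    (hP : Realizes P m) (hP' : Realizes P' m') (h : SameOrder m m') : F P = F P' :=
  hF.ordinal_margin_invariance P P' hP.1 hP'.1
    ⟨by simpa only [hP.2, hP'.2] using h.1, by simpa only [hP.2, hP'.2] using h.2⟩

theorem MeetsCriteria.wins_of_sameOrder (hF : MeetsCriteria F) (hx : Wins F m x)
    (h : SameOrder m m') (hm' : ∃ P : Profile Alt V, Realizes P m') : Wins F m' x := by
  obtain ⟨P, hP, hx⟩ := hx
  obtain ⟨P', hP'⟩ := hm'
  exact ⟨P', hP', hF.eq_of_sameOrder hP hP' h ▸ hx⟩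

theorem MeetsCriteria.wins_add_ballot [Infinite V] (hF : MeetsCriteria F)
    (hx : Wins F m x) {l : List Alt} (hl : ∀ y, y ∈ l) (hxl : ∀ y, y ≠ x → prefers l x y) :
    Wins F (fun u v => m u v + ballotMargin l u v) x := by
  obtain ⟨P, hP, hx⟩ := hx
  obtain ⟨P', j, hj, hvot, hold, hnew, hlin, hmar⟩ := exists_addVoter hP.1 hl
  exact ⟨P', ⟨hlin, fun u v => by rw [hmar, hP.2]⟩,
    hF.positive_involvement P P' j x hP.1 hlin hj hvot hold
      (fun y hy => (hnew x y).2 (hxl y hy)) hx⟩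

theorem MeetsCriteria.wins_add_ballots [Infinite V] (hF : MeetsCriteria F)
    (hx : Wins F m x) (L : List (List Alt))
    (hL : ∀ l ∈ L, (∀ y, y ∈ l) ∧ ∀ y, y ≠ x → prefers l x y) :
    Wins F (fun u v => m u v + ballotsMargin L u v) x := by
  induction L with
  | nil => simpa [ballotsMargin] using hx
  | cons l L ih =>
    have hl := hL l (by simp)
    have := hF.wins_add_ballot (ih fun l' h => hL l' (by simp [h])) hl.1 hl.2
    convert this using 3
    simp only [ballotsMargin, List.map_cons, List.sum_cons]
    ring

/-- A transition between margin functions, each representing an ordinal margin graph. -/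
theorem MeetsCriteria.wins_transition [Infinite V] (hF : MeetsCriteria F)
    {p' q' r' s' t' u' : ℤ} (p q r s t u : ℤ) (L : List (List Alt))
    (hx : Selects F m x)
    (h : SameOrder m (margins p q r s t u))
    (hL : ∀ l ∈ L, (∀ y, y ∈ l) ∧ ∀ y, y ≠ x → prefers l x y)
    (h' : SameOrder (fun x y => margins p q r s t u x y + ballotsMargin L x y)
      (margins p' q' r' s' t' u')) :
    Selects F (margins p' q' r' s' t' u') x := by
  have h₁ := hF.wins_of_sameOrder hx
    ((sameOrder_two_mul m).symm.trans (h.trans (sameOrder_two_mul _)))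
    (exists_realizes_two_mul_margins p q r s t u)
  have h₂ := hF.wins_add_ballots (hF.wins_add_ballots h₁ L hL) L hL
  refine hF.wins_of_sameOrder h₂ ?_ (exists_realizes_two_mul_margins p' q' r' s' t' u')
  have h₃ := (sameOrder_two_mul _).symm.trans (h'.trans (sameOrder_two_mul _))
  convert h₃ using 3
  ring

/-- The winner is unique if the ordinal margin graph is a linearly edge-ordered tournament. -/
theorem MeetsCriteria.wins_unique (hF : MeetsCriteria F) {y : Alt}
    (hx : Selects F m x) (hy : Selects F m y)
    (h₀ : ∀ u v, u ≠ v → m u v ≠ 0)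
    (h₁ : ∀ u v z w : Alt, u ≠ v → z ≠ w → ({u, v} : Finset Alt) ≠ {z, w} →
      |m u v| ≠ |m z w|) : x = y := by
  obtain ⟨P, hP, hx⟩ := hx
  obtain ⟨P', hP', hy⟩ := hy
  rw [← hF.eq_of_sameOrder hP hP' ⟨fun _ _ => Iff.rfl, fun _ _ _ _ _ _ => Iff.rfl⟩] at hy
  have hcard := hF.card_eq_one P hP.1
    (fun u v huv => by simpa only [hP.2] using mul_ne_zero two_ne_zero (h₀ u v huv))
    (fun u v z w huv hzw hne => by
      simpa only [hP.2, abs_mul] using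
        (mul_right_injective₀ (abs_ne_zero.2 two_ne_zero)).ne (h₁ u v z w huv hzw hne))
  exact Finset.card_le_one.1 hcard.le x hx y hy

theorem exists_ballot {x y : Alt} (h : y ≠ x) :
    ∃ l : List Alt, (∀ z, z ∈ l) ∧ (∀ z, z ≠ x → prefers l x z) ∧
      ∀ z, z ≠ x → z ≠ y → prefers l y z := by
  refine ⟨[x, y, a, b, c, d], ?_⟩
  revert x y
  decide

/-- A winner is defensible. -/
theorem MeetsCriteria.defensible_of_wins [Infinite V] (hF : MeetsCriteria F)
    {p q r s t u : ℤ} (hx : Selects F (margins p q r s t u) x) (y : Alt) :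
    ∃ z, margins p q r s t u y x ≤ margins p q r s t u z y := by
  by_contra! h
  have hpos := h y
  have hskew : ∀ z w, margins p q r s t u z w = -margins p q r s t u w z := by
    rintro (_ | _ | _ | _) (_ | _ | _ | _) <;> simp [margins]
  have hyx : y ≠ x := by
    rintro rfl
    exact lt_irrefl _ hpos
  obtain ⟨l, hl, hxl, hyl⟩ := exists_ballot hyx
  obtain ⟨P, hP, hx⟩ := hF.wins_add_ballots hx
    (List.replicate (2 * margins p q r s t u y x - 1).toNat l)
    (fun l' h' => by rw [List.eq_of_mem_replicate h']; exact ⟨hl, hxl⟩)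
  have hk : ((2 * margins p q r s t u y x - 1).toNat : ℤ) = 2 * margins p q r s t u y x - 1 := by
    have := hskew y y
    lia
  have hy := hF.condorcet_winner P y hP.1 fun z hz => by
    rw [hP.2]
    simp only [ballotsMargin, List.map_replicate, List.sum_replicate, nsmul_eq_mul, hk]
    rcases eq_or_ne z x with rfl | hzx
    · rw [ballotMargin, if_neg (hxl y hyx).not_gt, if_pos (hxl y hyx)]
      lia
    · have := h z
      have := hskew y z
      rw [ballotMargin, if_pos (hyl z hzx hz), if_neg (hyl z hzx hz).not_gt]
      lia
  rw [hy, Finset.mem_singleton] at hx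
  exact hyx hx.symm

/-- The alternatives not excluded by defensibility or the Condorcet loser criterion. -/
def Admissible (m : Alt → Alt → ℤ) (x : Alt) : Prop :=
  (∀ y, ∃ z, m y x ≤ m z y) ∧ ∃ y, y ≠ x ∧ m y x ≤ 0

instance (m : Alt → Alt → ℤ) (x : Alt) : Decidable (Admissible m x) :=
  inferInstanceAs (Decidable (_ ∧ _))

/-- Some alternative is selected, and it is not excluded. -/
theorem MeetsCriteria.exists_wins_admissible [Infinite V] (hF : MeetsCriteria F)
    (p q r s t u : ℤ) :
    ∃ x, Selects F (margins p q r s t u) x ∧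
      Admissible (margins p q r s t u) x := by
  obtain ⟨P, hP⟩ := exists_realizes_two_mul_margins (V := V) p q r s t u
  obtain ⟨x, hx⟩ := hF.nonempty P hP.1
  refine ⟨x, ⟨P, hP, hx⟩, hF.defensible_of_wins ⟨P, hP, hx⟩, ?_⟩
  by_contra! h
  exact hF.condorcet_loser P x hP.1
    (fun y hy => by simpa only [hP.2] using mul_pos two_pos (h y hy)) hx

theorem MeetsCriteria.not_selects_a [Infinite V] (hF : MeetsCriteria F) :
    ¬ Selects F (margins 6 1 (-3) 2 4 5) a := by
  intro ha
  have hb₀ : Selects F (margins 5 1 (-6) 2 3 4) b := by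
    obtain ⟨x, hx, hadm⟩ := hF.exists_wins_admissible 5 1 (-6) 2 3 4
    cases x
    · exact absurd hadm (by decide)
    · exact hx
    · have h : Selects F (margins 6 1 (-3) 2 4 5) c :=
        hF.wins_transition 7 3 (-8) 4 5 6
          [[c, a, b, d], [c, a, b, d]]
          hx (by decide) (by decide) (by decide)
      exact absurd (hF.wins_unique ha h (by decide) (by decide)) (by decide)
    · exact absurd hadm (by decide)
  have hd₀ : Selects F (margins 6 2 (-5) 3 4 1) d := by
    obtain ⟨x, hx, hadm⟩ := hF.exists_wins_admissible 6 2 (-5) 3 4 1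
    cases x
    · exact absurd hadm (by decide)
    · exact absurd hadm (by decide)
    · have h : Selects F (margins 6 1 (-3) 2 4 5) c :=
        hF.wins_transition 8 4 (-7) 5 6 3
          [[c, a, b, d], [c, a, d, b], [c, a, d, b]]
          hx (by decide) (by decide) (by decide)
      exact absurd (hF.wins_unique ha h (by decide) (by decide)) (by decide)
    · exact hx
  have hb : Selects F (margins 5 2 (-6) 3 4 1) b :=
    hF.wins_transition 8 1 (-9) 2 3 4
      [[b, a, d, c], [b, a, d, c]]
      hb₀ (by decide) (by decide) (by decide)
  have hd : Selects F (margins 5 2 (-6) 3 4 1) d :=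
    hF.wins_transition 7 3 (-6) 4 5 2
      [[d, c, b, a]]
      hd₀ (by decide) (by decide) (by decide)
  exact absurd (hF.wins_unique hb hd (by decide) (by decide)) (by decide)

theorem MeetsCriteria.not_selects_c [Infinite V] (hF : MeetsCriteria F) :
    ¬ Selects F (margins 6 1 (-3) 2 4 5) c := by
  intro hc
  have hc₀ : Selects F (margins 5 (-1) (-4) 3 6 2) c := by
    obtain ⟨x, hx, hadm⟩ := hF.exists_wins_admissible 5 (-1) (-4) 3 6 2
    cases x
    · have h : Selects F (margins 6 1 (-3) 2 4 5) a :=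
        hF.wins_transition 7 (-2) (-6) 5 8 3
          [[a, c, d, b], [a, c, d, b], [a, c, d, b]]
          hx (by decide) (by decide) (by decide)
      exact absurd (hF.wins_unique hc h (by decide) (by decide)) (by decide)
    · exact absurd hadm (by decide)
    · exact hx
    · exact absurd hadm (by decide)
  have hc' : Selects F (margins 4 (-1) (-5) 3 6 2) c :=
    hF.wins_transition 7 (-1) (-6) 5 8 2
      [[c, b, d, a]]
      hc₀ (by decide) (by decide) (by decide)
  have ha₂ : Selects F (margins 4 3 (-5) 2 6 (-1)) a := by
    obtain ⟨x, hx, hadm⟩ := hF.exists_wins_admissible 4 3 (-5) 2 6 (-1)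
    cases x
    · exact hx
    · have h : Selects F (margins 4 (-1) (-5) 3 6 2) b :=
        hF.wins_transition 11 3 (-12) 2 13 (-1)
          [[b, c, a, d], [b, c, a, d], [b, c, a, d], [b, c, a, d]]
          hx (by decide) (by decide) (by decide)
      exact absurd (hF.wins_unique hc' h (by decide) (by decide)) (by decide)
    · exact absurd hadm (by decide)
    · exact absurd hadm (by decide)
  have hc₂ : Selects F (margins 4 3 (-6) 2 5 1) c := by
    obtain ⟨x, hx, hadm⟩ := hF.exists_wins_admissible 4 3 (-6) 2 5 1
    cases x
    · exact absurd hadm (by decide)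
    · have h : Selects F (margins 4 (-1) (-5) 3 6 2) b :=
        hF.wins_transition 11 3 (-13) 2 12 1
          [[b, c, a, d], [b, c, a, d], [b, c, a, d], [b, c, a, d]]
          hx (by decide) (by decide) (by decide)
      exact absurd (hF.wins_unique hc' h (by decide) (by decide)) (by decide)
    · exact hx
    · exact absurd hadm (by decide)
  have ha₁ : Selects F (margins 4 3 (-5) 1 6 2) a :=
    hF.wins_transition 4 3 (-11) 2 12 (-1)
      [[a, b, c, d], [a, c, b, d], [a, c, b, d]]
      ha₂ (by decide) (by decide) (by decide)
  have hc₁ : Selects F (margins 4 3 (-5) 1 6 2) c :=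
    hF.wins_transition 5 4 (-7) 2 6 1
      [[c, b, a, d]]
      hc₂ (by decide) (by decide) (by decide)
  exact absurd (hF.wins_unique ha₁ hc₁ (by decide) (by decide)) (by decide)

end

/-- there is no voting method on profiles over {a,b,c,d}
satisfying positive involvement, the Condorcet winner and loser criteria,
ordinal margin invariance, and uniqueness of winners on profiles whose ordinal
margin graph is a linearly edge-ordered tournament. -/
theorem impossibility {V : Type*} [Infinite V] :
    ¬ ∃ F : Profile Alt V → Finset Alt,
      (∀ P : Profile Alt V, P.linear → (F P).Nonempty) ∧
      -- positive involvement
      (∀ (P P' : Profile Alt V) (j : V) (x : Alt), P.linear → P'.linear →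
        j ∉ P.voters → P'.voters = insert j P.voters →
        (∀ i ∈ P.voters, ∀ u v : Alt, P'.pref i u v ↔ P.pref i u v) →
        (∀ y : Alt, y ≠ x → P'.pref j x y) →
        x ∈ F P → x ∈ F P') ∧
      -- Condorcet winner criterion
      (∀ (P : Profile Alt V) (x : Alt), P.linear →
        (∀ y : Alt, y ≠ x → 0 < P.margin x y) → F P = {x}) ∧
      -- Condorcet loser criterion
      (∀ (P : Profile Alt V) (x : Alt), P.linear →
        (∀ y : Alt, y ≠ x → 0 < P.margin y x) → x ∉ F P) ∧
      -- ordinal margin invariance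
      (∀ P P' : Profile Alt V, P.linear → P'.linear → omgEq P P' → F P = F P') ∧
      -- unique winners on linearly edge-ordered tournaments
      (∀ P : Profile Alt V, P.linear →
        (∀ x y : Alt, x ≠ y → P.margin x y ≠ 0) →
        (∀ x y z w : Alt, x ≠ y → z ≠ w → ({x, y} : Finset Alt) ≠ {z, w} →
          |P.margin x y| ≠ |P.margin z w|) →
        (F P).card = 1) := by
  rintro ⟨F, h₁, h₂, h₃, h₄, h₅, h₆⟩
  have hF : MeetsCriteria F := ⟨h₁, h₂, h₃, h₄, h₅, h₆⟩
  obtain ⟨x, hx, hadm⟩ := hF.exists_wins_admissible 6 1 (-3) 2 4 5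
  cases x
  · exact hF.not_selects_a hx
  · exact absurd hadm (by decide)
  · exact hF.not_selects_c hx
  · exact absurd hadm (by decide)
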